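/- Assume N ≥ 3 and 2 < p < 2N/(N-2), or N = 2 and 2 < p < 6. Then for every c > 0 there exist λ ∈ ℝ with λ > -λ₁ and a positive radial solution u of (NLS_λ) on the annulus T with m(u) = c. -/

import Mathlib

open Set MeasureTheory Filter Topology

noncomputable section

/-- `u` is a positive radial solution of (NLS_lam) on the annulus
`T = {x ∈ ℝ^N : 1 < |x| < 2}`: `u ∈ C²([1,2])`, `u > 0` on `(1,2)`,
`u(1) = u(2) = 0`, and `-(u'' + ((N-1)/r) u') + lam u = u^(p-1)` on `(1,2)`. -/
def IsPosRadSol (N : ℕ) (p lam : ℝ) (u : ℝ → ℝ) : Prop :=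
  ContDiffOn ℝ 2 u (Icc 1 2) ∧
  (∀ r ∈ Ioo (1:ℝ) 2, 0 < u r) ∧
  u 1 = 0 ∧ u 2 = 0 ∧
  ∀ r ∈ Ioo (1:ℝ) 2,
    -(deriv (deriv u) r + (((N : ℝ) - 1) / r) * deriv u r) + lam * u r = u r ^ (p - 1)

/-- The radial mass `m(u) = ∫₁² u(r)² r^(N-1) dr`. -/
def mass (N : ℕ) (u : ℝ → ℝ) : ℝ := ∫ r in (1:ℝ)..2, (u r) ^ 2 * r ^ (N - 1)

/-- The first radial Dirichlet eigenvalue of `-Δ` on the annulus. -/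
def lambda1 (N : ℕ) : ℝ :=
  sInf { q : ℝ | ∃ φ : ℝ → ℝ, ContDiffOn ℝ 1 φ (Icc 1 2) ∧ φ 1 = 0 ∧ φ 2 = 0 ∧
    (∃ r ∈ Icc (1:ℝ) 2, φ r ≠ 0) ∧
    q = (∫ r in (1:ℝ)..2, (deriv φ r) ^ 2 * r ^ (N - 1)) /
        (∫ r in (1:ℝ)..2, (φ r) ^ 2 * r ^ (N - 1)) }

/-- Admissible pair: a `C¹` function together with its derivative, vanishing at `1` and `2`. -/
def Adm (v v' : ℝ → ℝ) : Prop :=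
  (∀ x, HasDerivAt v (v' x) x) ∧ Continuous v' ∧ v 1 = 0 ∧ v 2 = 0

def MM (w v : ℝ → ℝ) : ℝ := ∫ x in (1:ℝ)..2, v x ^ 2 * w x

def PP (p : ℝ) (w v : ℝ → ℝ) : ℝ := ∫ x in (1:ℝ)..2, |v x| ^ p * w x

lemma Adm.cont {v v' : ℝ → ℝ} (h : Adm v v') : Continuous v :=
  continuous_iff_continuousAt.2 fun x => (h.1 x).continuousAt

lemma Adm.smul {v v' : ℝ → ℝ} (h : Adm v v') (s : ℝ) :
    Adm (fun x => s * v x) (fun x => s * v' x) := by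
  obtain ⟨h1, h2, h3, h4⟩ := h
  exact ⟨fun x => (h1 x).const_mul s, by fun_prop, by simp [h3], by simp [h4]⟩

lemma Adm.add_smul {v v' η η' : ℝ → ℝ} (h : Adm v v') (h' : Adm η η') (t : ℝ) :
    Adm (fun x => v x + t * η x) (fun x => v' x + t * η' x) := by
  obtain ⟨h1, h2, h3, h4⟩ := h
  obtain ⟨g1, g2, g3, g4⟩ := h'
  exact ⟨fun x => (h1 x).add ((g1 x).const_mul t), by fun_prop, by simp [h3, g3], by simp [h4, g4]⟩

lemma MM_smul (w v : ℝ → ℝ) (s : ℝ) : MM w (fun x => s * v x) = s ^ 2 * MM w v := by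
  unfold MM
  rw [← intervalIntegral.integral_const_mul]
  congr 1; ext x; ring

lemma PP_smul (p : ℝ) (w v : ℝ → ℝ) (s : ℝ) (hs : 0 ≤ s) :
    PP p w (fun x => s * v x) = s ^ p * PP p w v := by
  unfold PP
  rw [← intervalIntegral.integral_const_mul]
  congr 1; ext x
  rw [abs_mul, abs_of_nonneg hs, Real.mul_rpow hs (abs_nonneg _)]; ring

lemma MM_nonneg {w : ℝ → ℝ} (hw1 : ∀ x, 1 ≤ w x) (v : ℝ → ℝ) : 0 ≤ MM w v := by
  apply intervalIntegral.integral_nonneg (by norm_num)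
  intro x _
  have := hw1 x
  positivity

lemma PP_nonneg {w : ℝ → ℝ} (p : ℝ) (hw1 : ∀ x, 1 ≤ w x) (v : ℝ → ℝ) : 0 ≤ PP p w v := by
  apply intervalIntegral.integral_nonneg (by norm_num)
  intro x _
  have := hw1 x
  positivity

lemma sup_bound {w v v' : ℝ → ℝ} (hw : Continuous w) (hw1 : ∀ x, 1 ≤ w x) (h : Adm v v')
    {a : ℝ} (ha : 0 < a) {x : ℝ} (hx : x ∈ Icc (1:ℝ) 2) :
    v x ^ 2 ≤ a * MM w v + MM w v' / a := by
  have hv := h.cont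
  obtain ⟨h1, h2, h3, h4⟩ := h
  have e1 : ∫ y in (1:ℝ)..x, 2 * v y * v' y = v x ^ 2 := by
    rw [intervalIntegral.integral_eq_sub_of_hasDerivAt (f := fun y => v y ^ 2)]
    · simp [h3]
    · intro y _
      simpa using (h1 y).fun_pow 2
    · exact (by fun_prop : Continuous _).intervalIntegrable _ _
  have e2 : ∫ y in (1:ℝ)..x, 2 * v y * v' y ≤
      ∫ y in (1:ℝ)..x, (a * (v y ^ 2 * w y) + (v' y ^ 2 * w y) / a) := by
    apply intervalIntegral.integral_mono_on hx.1
    · exact (by fun_prop : Continuous _).intervalIntegrable _ _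
    · exact (by fun_prop : Continuous _).intervalIntegrable _ _
    · intro y _
      have hwy := hw1 y
      have k1 : 2 * v y * v' y ≤ a * v y ^ 2 + v' y ^ 2 / a := by
        have : a * v y ^ 2 + v' y ^ 2 / a - 2 * v y * v' y = (a * v y - v' y) ^ 2 / a := by
          field_simp; ring
        have h0 : 0 ≤ (a * v y - v' y) ^ 2 / a := by positivity
        linarith
      have k2 : a * v y ^ 2 + v' y ^ 2 / a ≤ (a * v y ^ 2 + v' y ^ 2 / a) * w y :=
        le_mul_of_one_le_right (by positivity) hwy
      calc _ ≤ _ := k1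
        _ ≤ _ := k2
        _ = _ := by ring
  have e3 : ∫ y in (1:ℝ)..x, (a * (v y ^ 2 * w y) + (v' y ^ 2 * w y) / a) ≤
      ∫ y in (1:ℝ)..2, (a * (v y ^ 2 * w y) + (v' y ^ 2 * w y) / a) := by
    apply intervalIntegral.integral_mono_interval le_rfl hx.1 hx.2
    · filter_upwards with y
      have := hw1 y
      simp only [Pi.zero_apply]
      positivity
    · exact (by fun_prop : Continuous _).intervalIntegrable _ _
  have e4 : ∫ y in (1:ℝ)..2, (a * (v y ^ 2 * w y) + (v' y ^ 2 * w y) / a) =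
      a * MM w v + MM w v' / a := by
    unfold MM
    rw [intervalIntegral.integral_add, intervalIntegral.integral_const_mul,
      intervalIntegral.integral_div]
    · exact (by fun_prop : Continuous _).intervalIntegrable _ _
    · exact (by fun_prop : Continuous _).intervalIntegrable _ _
  linarith

lemma sup_bound' {w v v' : ℝ → ℝ} (hw : Continuous w) (hw1 : ∀ x, 1 ≤ w x) (h : Adm v v')
    {c : ℝ} (hc : 0 < c) (hM : MM w v = c) {x : ℝ} (hx : x ∈ Icc (1:ℝ) 2) :
    v x ^ 2 ≤ 2 * Real.sqrt (c * (MM w v' + 1)) := by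
  have hD := MM_nonneg hw1 v'
  set D := MM w v' with hDdef
  have hs : 0 < Real.sqrt (c * (D + 1)) := Real.sqrt_pos.2 (by positivity)
  have hss : Real.sqrt (c * (D + 1)) ^ 2 = c * (D + 1) := Real.sq_sqrt (by positivity)
  set s := Real.sqrt (c * (D + 1))
  have := sup_bound hw hw1 h (a := s / c) (by positivity) hx
  rw [hM, ← hDdef] at this
  have e : s / c * c + D / (s / c) = s + c * D / s := by field_simp
  rw [e] at this
  have : c * D / s ≤ s := by
    rw [div_le_iff₀ hs]; nlinarith
  linarith

lemma holder {w v v' : ℝ → ℝ} (hw : Continuous w) (hw1 : ∀ x, 1 ≤ w x) (h : Adm v v')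
    {x y : ℝ} (hx : x ∈ Icc (1:ℝ) 2) (hy : y ∈ Icc (1:ℝ) 2) :
    |v x - v y| ≤ (MM w v' + 1) * Real.sqrt |x - y| := by
  wlog hxy : y ≤ x generalizing x y
  · have := this hy hx (by linarith)
    rwa [abs_sub_comm, abs_sub_comm x y]
  rcases eq_or_lt_of_le hxy with rfl | hlt
  · simp
  have hv := h.cont
  obtain ⟨h1, h2, h3, h4⟩ := h
  have hD := MM_nonneg hw1 v'
  rw [abs_of_nonneg (sub_nonneg.2 hxy)]
  have hs : 0 < Real.sqrt (x - y) := Real.sqrt_pos.2 (by linarith)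
  have hss : Real.sqrt (x - y) ^ 2 = x - y := Real.sq_sqrt (by linarith)
  set a := Real.sqrt (x - y)
  have e1 : ∫ z in y..x, v' z = v x - v y := by
    rw [intervalIntegral.integral_eq_sub_of_hasDerivAt (f := v)]
    · intro z _
      exact h1 z
    · exact h2.intervalIntegrable _ _
  have e2 : |∫ z in y..x, v' z| ≤ ∫ z in y..x, |v' z| :=
    intervalIntegral.abs_integral_le_integral_abs hxy
  have e3 : ∫ z in y..x, |v' z| ≤ ∫ z in y..x, (a * (v' z ^ 2 * w z) + 1 / a) := by
    apply intervalIntegral.integral_mono_on hxy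
    · exact (by fun_prop : Continuous _).intervalIntegrable _ _
    · exact (by fun_prop : Continuous _).intervalIntegrable _ _
    · intro z _
      have hwz := hw1 z
      have k1 : |v' z| ≤ a * v' z ^ 2 + 1 / a := by
        rw [← sq_abs]
        have : a * |v' z| ^ 2 + 1 / a - 2 * |v' z| = (a * |v' z| - 1) ^ 2 / a := by
          field_simp; ring
        have h0 : 0 ≤ (a * |v' z| - 1) ^ 2 / a := by positivity
        have := abs_nonneg (v' z)
        linarith
      have k2 : v' z ^ 2 ≤ v' z ^ 2 * w z := le_mul_of_one_le_right (by positivity) hwz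
      nlinarith
  have e4 : ∫ z in y..x, (a * (v' z ^ 2 * w z) + 1 / a) =
      a * (∫ z in y..x, v' z ^ 2 * w z) + (x - y) / a := by
    rw [intervalIntegral.integral_add, intervalIntegral.integral_const_mul,
      intervalIntegral.integral_const]
    · simp [div_eq_mul_inv]
    · exact (by fun_prop : Continuous _).intervalIntegrable _ _
    · exact (by fun_prop : Continuous _).intervalIntegrable _ _
  have e5 : ∫ z in y..x, v' z ^ 2 * w z ≤ MM w v' := by
    apply intervalIntegral.integral_mono_interval hy.1 hxy hx.2
    · filter_upwards with y
      have := hw1 y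
      simp only [Pi.zero_apply]
      positivity
    · exact (by fun_prop : Continuous _).intervalIntegrable _ _
  have e6 : (x - y) / a = a := by rw [← hss]; field_simp
  rw [← e1]
  rw [e4, e6] at e3
  nlinarith

lemma PP_le {p : ℝ} (hp : 2 < p) {w v v' : ℝ → ℝ} (hw : Continuous w) (hw1 : ∀ x, 1 ≤ w x)
    (h : Adm v v') {c : ℝ} (hc : 0 < c) (hM : MM w v = c) :
    PP p w v ≤ c * (4 * c) ^ ((p - 2) / 4) * (MM w v' + 1) ^ ((p - 2) / 4) := by
  have hD := MM_nonneg hw1 v'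
  have hv := h.cont
  have key : ∀ x ∈ Icc (1:ℝ) 2, |v x| ^ p * w x ≤
      (4 * c * (MM w v' + 1)) ^ ((p - 2) / 4) * (v x ^ 2 * w x) := by
    intro x hx
    have h0 := sup_bound' hw hw1 h hc hM hx
    have h1 : v x ^ 4 ≤ 4 * c * (MM w v' + 1) := by
      have hsq : Real.sqrt (c * (MM w v' + 1)) ^ 2 = c * (MM w v' + 1) :=
        Real.sq_sqrt (by positivity)
      have hn := Real.sqrt_nonneg (c * (MM w v' + 1))
      have : (v x ^ 2) ^ 2 ≤ (2 * Real.sqrt (c * (MM w v' + 1))) ^ 2 :=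
        pow_le_pow_left₀ (by positivity) h0 2
      nlinarith
    have h2 : |v x| ^ (p - 2) ≤ (4 * c * (MM w v' + 1)) ^ ((p - 2) / 4) := by
      have : |v x| ^ (p - 2) = (v x ^ 4) ^ ((p - 2) / 4) := by
        have e : v x ^ 4 = |v x| ^ (4:ℝ) := by
          have : |v x| ^ (4:ℝ) = |v x| ^ 4 := by exact_mod_cast Real.rpow_natCast (|v x|) 4
          rw [this, Even.pow_abs (by decide)]
        rw [e, ← Real.rpow_mul (abs_nonneg _)]
        congr 1; ring
      rw [this]
      exact Real.rpow_le_rpow (by positivity) h1 (by linarith)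
    have h3 : |v x| ^ p = |v x| ^ (p - 2) * v x ^ 2 := by
      have : |v x| ^ p = |v x| ^ ((p - 2) + 2) := by congr 1; ring
      rw [this, Real.rpow_add' (abs_nonneg _) (by linarith), ← sq_abs]
      norm_num
    rw [h3, mul_assoc]
    have := hw1 x
    exact mul_le_mul_of_nonneg_right h2 (by positivity)
  have e : PP p w v ≤ ∫ x in (1:ℝ)..2, (4 * c * (MM w v' + 1)) ^ ((p - 2) / 4) * (v x ^ 2 * w x) := by
    apply intervalIntegral.integral_mono_on (by norm_num) _ _ key
    · refine Continuous.intervalIntegrable ?_ _ _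
      exact (hv.abs.rpow_const (fun x => Or.inr (by linarith))).mul hw
    · exact (by fun_prop : Continuous _).intervalIntegrable _ _
  rw [intervalIntegral.integral_const_mul] at e
  have e' : (∫ x in (1:ℝ)..2, v x ^ 2 * w x) = c := hM
  rw [e', Real.mul_rpow (by positivity) (by positivity)] at e
  linarith

lemma coercive {p : ℝ} (hp : 2 < p) (hp6 : p < 6) {w : ℝ → ℝ} (hw : Continuous w)
    (hw1 : ∀ x, 1 ≤ w x) {c : ℝ} (hc : 0 < c) {k : ℝ} (hk : 0 ≤ k) :
    ∃ C : ℝ, ∀ v v' : ℝ → ℝ, Adm v v' → MM w v = c →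
      k / p * PP p w v ≤ MM w v' / 4 + C := by
  set θ := (p - 2) / 4 with hθ
  have hθ0 : 0 < θ := by rw [hθ]; linarith
  have hθ1 : θ < 1 := by rw [hθ]; linarith
  set K := k / p * (c * (4 * c) ^ θ) with hK
  have hK0 : 0 ≤ K := by positivity
  have hlo := tendsto_rpow_neg_atTop (show (0:ℝ) < 1 - θ by linarith)
  have hev := hlo.eventually (gt_mem_nhds (show (0:ℝ) < 1 / (4 * (K + 1)) by positivity))
  obtain ⟨X, hX'⟩ := eventually_atTop.1 hev
  have hX : ∀ x, X ≤ x → 0 ≤ x → x ^ θ ≤ 1 / (4 * (K + 1)) * x := by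
    intro x hx hx0
    rcases eq_or_lt_of_le hx0 with rfl | hpos
    · rw [Real.zero_rpow hθ0.ne']; simp
    have e : x ^ θ = x ^ (-(1 - θ)) * x := by
      nth_rewrite 3 [← Real.rpow_one x]
      rw [← Real.rpow_add hpos]; congr 1; ring
    rw [e]
    exact mul_le_mul_of_nonneg_right (hX' x hx).le hx0
  have hx1 : ∀ x, 0 ≤ x → K * x ^ θ ≤ x / 4 + K * (max X 0) ^ θ := by
    intro x hx
    rcases le_total (max X 0) x with h | h
    · have := hX x (le_trans (le_max_left _ _) h) hx
      have h2 : K * x ^ θ ≤ (K + 1) * (1 / (4 * (K + 1)) * x) := by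
        have : 0 ≤ x ^ θ := by positivity
        nlinarith
      have h3 : (K + 1) * (1 / (4 * (K + 1)) * x) = x / 4 := by field_simp
      have : 0 ≤ K * (max X 0) ^ θ := by positivity
      linarith
    · have : x ^ θ ≤ (max X 0) ^ θ := Real.rpow_le_rpow hx h hθ0.le
      have := mul_le_mul_of_nonneg_left this hK0
      linarith
  refine ⟨1 / 4 + K * (max X 0) ^ θ, fun v v' h hM => ?_⟩
  have h1 := PP_le hp hw hw1 h hc hM
  have hD := MM_nonneg hw1 v'
  have h2 := hx1 (MM w v' + 1) (by linarith)
  have h3 : k / p * PP p w v ≤ k / p * (c * (4 * c) ^ θ * (MM w v' + 1) ^ θ) :=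
    mul_le_mul_of_nonneg_left h1 (by positivity)
  have h4 : k / p * (c * (4 * c) ^ θ * (MM w v' + 1) ^ θ) = K * (MM w v' + 1) ^ θ := by
    rw [hK]; ring
  linarith

/-- Clamping to `[1,2]`. -/
def cl (x : ℝ) : ℝ := max 1 (min x 2)

lemma cl_cont : Continuous cl := by unfold cl; fun_prop

lemma cl_mem (x : ℝ) : cl x ∈ Icc (1:ℝ) 2 :=
  ⟨le_max_left _ _, max_le (by norm_num) (min_le_right _ _)⟩

lemma cl_eq {x : ℝ} (hx : x ∈ Icc (1:ℝ) 2) : cl x = x := by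
  unfold cl; rw [min_eq_left hx.2, max_eq_right hx.1]

lemma compact_seq {B K : ℝ} (v : ℕ → ℝ → ℝ)
    (hB : ∀ n, ∀ x ∈ Icc (1:ℝ) 2, |v n x| ≤ B)
    (hK : ∀ n, ∀ x ∈ Icc (1:ℝ) 2, ∀ y ∈ Icc (1:ℝ) 2, |v n x - v n y| ≤ K * Real.sqrt |x - y|) :
    ∃ u : ℝ → ℝ, ∃ φ : ℕ → ℕ, Continuous u ∧ StrictMono φ ∧
      ∀ x ∈ Icc (1:ℝ) 2, Tendsto (fun n => v (φ n) x) atTop (𝓝 (u x)) := by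
  let X := Icc (1:ℝ) 2
  let S : Set C(X, ℝ) := {f | (∀ x, |f x| ≤ B) ∧
    ∀ x y : X, |f x - f y| ≤ K * Real.sqrt |(x:ℝ) - y|}
  have hcont : ∀ f : X → ℝ, (∀ x y : X, |f x - f y| ≤ K * Real.sqrt |(x:ℝ) - y|) →
      Continuous f := by
    intro f hf
    rw [continuous_iff_continuousAt]
    intro x
    rw [ContinuousAt, tendsto_iff_dist_tendsto_zero]
    have h0 : Tendsto (fun y : X => K * Real.sqrt |(y:ℝ) - x|) (𝓝 x) (𝓝 0) := by
      have : Continuous (fun y : X => K * Real.sqrt |(y:ℝ) - x|) := by fun_prop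
      have := this.tendsto x
      simpa using this
    exact squeeze_zero (fun _ => dist_nonneg) (fun y => by rw [Real.dist_eq]; exact hf y x) h0
  have hS : IsCompact S := by
    apply ArzelaAscoli.isCompact_of_equicontinuous
    · have himg : ContinuousMap.toFun '' S = (Set.pi univ fun _ : X => Icc (-B) B) ∩
          {f | ∀ x y : X, |f x - f y| ≤ K * Real.sqrt |(x:ℝ) - y|} := by
        ext f
        constructor
        · rintro ⟨g, ⟨hg1, hg2⟩, rfl⟩
          exact ⟨fun x _ => abs_le.1 (hg1 x), hg2⟩
        · rintro ⟨h1, h2⟩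
          exact ⟨⟨f, hcont f h2⟩, ⟨fun x => abs_le.2 (h1 x (mem_univ _)), h2⟩, rfl⟩
      rw [himg]
      apply (isCompact_univ_pi fun _ => isCompact_Icc).inter_right
      simp only [Set.ofPred_forall]
      refine isClosed_iInter fun x => isClosed_iInter fun y => ?_
      exact isClosed_le (by fun_prop) continuous_const
    · intro x
      rw [Metric.equicontinuousAt_iff]
      intro ε hε
      have h0 : Tendsto (fun y : X => K * Real.sqrt |(x:ℝ) - y|) (𝓝 x) (𝓝 0) := by
        have : Continuous (fun y : X => K * Real.sqrt |(x:ℝ) - y|) := by fun_prop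
        have := this.tendsto x
        simpa using this
      obtain ⟨δ, hδ, h⟩ := Metric.eventually_nhds_iff.1 (h0.eventually (gt_mem_nhds hε))
      refine ⟨δ, hδ, fun y hy f => ?_⟩
      rw [Real.dist_eq]
      exact lt_of_le_of_lt (f.2.2 x y) (h hy)
  let V : ℕ → C(X, ℝ) := fun n => ⟨fun x => v n x, hcont _ fun x y => hK n x x.2 y y.2⟩
  have hV : ∀ n, V n ∈ S := fun n => ⟨fun x => hB n x x.2, fun x y => hK n x x.2 y y.2⟩
  obtain ⟨U, _, φ, hφ, hlim⟩ := hS.tendsto_subseq hV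
  refine ⟨fun x => U ⟨cl x, cl_mem x⟩, φ, ?_, hφ, ?_⟩
  · exact U.continuous.comp (cl_cont.subtype_mk _)
  · intro x hx
    have h1 : Tendsto (fun n => (V (φ n)) ⟨x, hx⟩) atTop (𝓝 (U ⟨x, hx⟩)) :=
      ((continuous_eval_const (⟨x, hx⟩ : X)).tendsto U).comp hlim
    have e : (⟨cl x, cl_mem x⟩ : X) = ⟨x, hx⟩ := Subtype.ext (cl_eq hx)
    simp only [e]
    exact h1

lemma limit_lemma {G : ℝ → ℝ → ℝ} (hG : Continuous fun q : ℝ × ℝ => G q.1 q.2)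
    {v : ℕ → ℝ → ℝ} {u : ℝ → ℝ} {B : ℝ} (hv : ∀ n, Continuous (v n))
    (hB : ∀ n, ∀ x ∈ Icc (1:ℝ) 2, |v n x| ≤ B)
    (hlim : ∀ x ∈ Icc (1:ℝ) 2, Tendsto (fun n => v n x) atTop (𝓝 (u x))) :
    Tendsto (fun n => ∫ x in (1:ℝ)..2, G x (v n x)) atTop (𝓝 (∫ x in (1:ℝ)..2, G x (u x))) := by
  have hcpt : IsCompact (Icc (1:ℝ) 2 ×ˢ Icc (-B) B) := isCompact_Icc.prod isCompact_Icc
  obtain ⟨C, hC⟩ := hcpt.exists_bound_of_continuousOn hG.continuousOn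
  have hsub : ∀ x, x ∈ uIoc (1:ℝ) 2 → x ∈ Icc (1:ℝ) 2 := by
    intro x hx
    rw [uIoc_of_le (by norm_num)] at hx
    exact Ioc_subset_Icc_self hx
  apply intervalIntegral.tendsto_integral_filter_of_dominated_convergence (fun _ => C)
  · filter_upwards with n
    have : Continuous fun x => G x (v n x) := hG.comp (continuous_id.prodMk (hv n))
    exact this.aestronglyMeasurable
  · filter_upwards with n
    filter_upwards with x hx
    exact hC (x, v n x) ⟨hsub x hx, abs_le.1 (hB n x (hsub x hx))⟩
  · simp
  · filter_upwards with x hx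
    have h1 := hlim x (hsub x hx)
    exact (hG.tendsto (x, u x)).comp (tendsto_const_nhds.prodMk_nhds h1)

def EE (p k : ℝ) (w v v' : ℝ → ℝ) : ℝ := MM w v' / 2 - k / p * PP p w v

lemma scaling {p k c I : ℝ} {w : ℝ → ℝ} (hc : 0 < c)
    (hI : ∀ v v' : ℝ → ℝ, Adm v v' → MM w v = c → I ≤ EE p k w v v')
    {v v' : ℝ → ℝ} (h : Adm v v') (hM : 0 < MM w v) :
    I ≤ c / MM w v * (MM w v') / 2 - k / p * ((c / MM w v) ^ (p / 2) * PP p w v) := by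
  set s := Real.sqrt (c / MM w v) with hs
  have hs2 : s ^ 2 = c / MM w v := Real.sq_sqrt (by positivity)
  have hs0 : 0 ≤ s := Real.sqrt_nonneg _
  have h1 := hI _ _ (h.smul s) (by rw [MM_smul, hs2]; field_simp)
  rw [EE, MM_smul, PP_smul _ _ _ _ hs0, hs2] at h1
  have h2 : s ^ p = (c / MM w v) ^ (p / 2) := by
    rw [← hs2, ← Real.rpow_natCast s 2, ← Real.rpow_mul hs0]
    congr 1; push_cast; ring
  rw [h2] at h1
  exact h1

lemma MM_pos {w u : ℝ → ℝ} (hw : Continuous w) (hw1 : ∀ x, 1 ≤ w x) (hu : Continuous u)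
    {x : ℝ} (hx : x ∈ Icc (1:ℝ) 2) (hne : u x ≠ 0) : 0 < MM w u := by
  apply intervalIntegral.integral_pos (by norm_num) (by fun_prop)
  · intro y _
    have := hw1 y
    positivity
  · refine ⟨x, hx, ?_⟩
    have := hw1 x
    positivity

lemma exists_test {w : ℝ → ℝ} (hw : Continuous w) (hw1 : ∀ x, 1 ≤ w x) {c : ℝ} (hc : 0 < c) :
    ∃ v v' : ℝ → ℝ, Adm v v' ∧ MM w v = c := by
  have h : Adm (fun x => (x - 1) * (2 - x)) (fun x => 1 * (2 - x) + (x - 1) * (-1)) := by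
    refine ⟨fun x => ?_, by fun_prop, by norm_num, by norm_num⟩
    exact ((hasDerivAt_id x).sub_const 1).mul ((hasDerivAt_id x).const_sub 2)
  have hM := MM_pos hw hw1 h.cont (x := 3/2) (by constructor <;> norm_num) (by norm_num)
  set v : ℝ → ℝ := fun x => (x - 1) * (2 - x)
  refine ⟨_, _, h.smul (Real.sqrt (c / MM w v)), ?_⟩
  rw [MM_smul, Real.sq_sqrt (by positivity)]
  field_simp

lemma regularize {w v v' : ℝ → ℝ} (hw : Continuous w) (hw1 : ∀ x, 1 ≤ w x) (h : Adm v v')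
    {ε : ℝ} (hε : 0 < ε) : ∃ z z' : ℝ → ℝ, Adm z z' ∧ MM w z' ≤ MM w v' ∧
      ∀ x, |z x - abs (v x)| ≤ ε := by
  have hv := h.cont
  obtain ⟨h1, h2, h3, h4⟩ := h
  have hpos : ∀ x, 0 < v x ^ 2 + ε ^ 2 := fun x => by positivity
  have hspos : ∀ x, 0 < Real.sqrt (v x ^ 2 + ε ^ 2) := fun x => Real.sqrt_pos.2 (hpos x)
  have hc' : Continuous (fun x => v x * v' x / Real.sqrt (v x ^ 2 + ε ^ 2)) := by
    apply Continuous.div (by fun_prop) (by fun_prop)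
    exact fun x => (hspos x).ne'
  refine ⟨fun x => Real.sqrt (v x ^ 2 + ε ^ 2) - ε,
    fun x => v x * v' x / Real.sqrt (v x ^ 2 + ε ^ 2), ⟨?_, ?_, ?_, ?_⟩, ?_, ?_⟩
  · intro x
    have := ((((h1 x).fun_pow 2).add_const (ε ^ 2)).sqrt (hpos x).ne').sub_const ε
    refine this.congr_deriv ?_
    have := (hspos x).ne'
    push_cast
    field_simp
  · exact hc'
  · simp [h3, Real.sqrt_sq hε.le]
  · simp [h4, Real.sqrt_sq hε.le]
  · apply intervalIntegral.integral_mono_on (by norm_num)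
    · exact (by fun_prop : Continuous _).intervalIntegrable _ _
    · exact (by fun_prop : Continuous _).intervalIntegrable _ _
    · intro x _
      have hwx := hw1 x
      apply mul_le_mul_of_nonneg_right _ (by linarith)
      rw [div_pow, Real.sq_sqrt (hpos x).le, div_le_iff₀ (hpos x)]
      nlinarith [sq_nonneg (v' x * ε)]
  · intro x
    have a1 : |v x| ≤ Real.sqrt (v x ^ 2 + ε ^ 2) := by
      apply Real.abs_le_sqrt; nlinarith
    have a2 : Real.sqrt (v x ^ 2 + ε ^ 2) ≤ |v x| + ε := by
      rw [Real.sqrt_le_left (by positivity)]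
      rw [← sq_abs (v x)]
      nlinarith [abs_nonneg (v x)]
    rw [abs_le]; constructor <;> linarith

lemma MM_add {w v v' η η' f : ℝ → ℝ} (hw : Continuous w) (h : Adm v v') (h' : Adm η η')
    (hf : Continuous f) (hd : ∀ x, HasDerivAt (fun y => w y * η' y) (f x) x) (t : ℝ) :
    MM w (fun x => v' x + t * η' x) =
      MM w v' - 2 * t * (∫ x in (1:ℝ)..2, v x * f x) + t ^ 2 * MM w η' := by
  have hv := h.cont
  obtain ⟨h1, h2, h3, h4⟩ := h
  obtain ⟨g1, g2, g3, g4⟩ := h'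
  have ibp := intervalIntegral.integral_mul_deriv_eq_deriv_mul (a := 1) (b := 2) (u := v)
    (u' := v') (v := fun y => w y * η' y) (v' := f) (fun x _ => h1 x) (fun x _ => hd x)
    (h2.intervalIntegrable _ _) (hf.intervalIntegrable _ _)
  rw [h3, h4] at ibp
  have e : MM w (fun x => v' x + t * η' x) =
      ∫ x in (1:ℝ)..2, (v' x ^ 2 * w x + (2 * t) * (v' x * (w x * η' x)) +
        t ^ 2 * (η' x ^ 2 * w x)) := by
    unfold MM; congr 1; ext x; ring
  rw [e, intervalIntegral.integral_add, intervalIntegral.integral_add,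
    intervalIntegral.integral_const_mul, intervalIntegral.integral_const_mul, ibp]
  · unfold MM; ring
  all_goals exact (by fun_prop : Continuous _).intervalIntegrable _ _

lemma exists_limit {p : ℝ} (hp : 2 < p) (hp6 : p < 6) {w : ℝ → ℝ} (hw : Continuous w)
    (hw1 : ∀ x, 1 ≤ w x) {c : ℝ} (hc : 0 < c) {k : ℝ} (hk : 0 ≤ k) :
    ∃ (u : ℝ → ℝ) (d I : ℝ), Continuous u ∧ (∀ x, 0 ≤ u x) ∧ MM w u = c ∧
      d / 2 - k / p * PP p w u = I ∧
      (∀ v v' : ℝ → ℝ, Adm v v' → MM w v = c → I ≤ EE p k w v v') ∧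
      ∀ η η' f : ℝ → ℝ, Adm η η' → Continuous f →
        (∀ x, HasDerivAt (fun y => w y * η' y) (f x) x) → ∀ t : ℝ,
        0 < MM w (fun x => u x + t * η x) →
        I ≤ c / MM w (fun x => u x + t * η x) *
            (d - 2 * t * (∫ x in (1:ℝ)..2, u x * f x) + t ^ 2 * MM w η') / 2 -
          k / p * ((c / MM w (fun x => u x + t * η x)) ^ (p / 2) *
            PP p w (fun x => u x + t * η x)) := by
  obtain ⟨C, hC⟩ := coercive hp hp6 hw hw1 hc hk
  let S : Set ℝ := {e | ∃ v v' : ℝ → ℝ, Adm v v' ∧ MM w v = c ∧ e = EE p k w v v'}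
  have hSne : S.Nonempty := by
    obtain ⟨v, v', h, hM⟩ := exists_test hw hw1 hc
    exact ⟨_, v, v', h, hM, rfl⟩
  have hcoer : ∀ v v' : ℝ → ℝ, Adm v v' → MM w v = c → MM w v' / 4 - C ≤ EE p k w v v' := by
    intro v v' h hM
    have := hC v v' h hM
    unfold EE; linarith
  have hSb : BddBelow S := by
    refine ⟨-C, ?_⟩
    rintro e ⟨v, v', h, hM, rfl⟩
    have := hcoer v v' h hM
    have := MM_nonneg hw1 v'
    linarith
  set I := sInf S with hIdef
  have hI : ∀ v v' : ℝ → ℝ, Adm v v' → MM w v = c → I ≤ EE p k w v v' :=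
    fun v v' h hM => csInf_le hSb ⟨v, v', h, hM, rfl⟩
  obtain ⟨e, -, hetend, heS⟩ := exists_seq_tendsto_sInf hSne hSb
  choose v v' hadm hmass hE using heS
  obtain ⟨Emax, hEmax⟩ := hetend.bddAbove_range
  have hE1 : ∀ n, e n ≤ Emax := fun n => hEmax ⟨n, rfl⟩
  set Dm := 4 * (Emax + C) with hDm
  have hD : ∀ n, MM w (v' n) ≤ Dm := by
    intro n
    have h1 := hcoer _ _ (hadm n) (hmass n)
    rw [← hE n] at h1
    have := hE1 n
    linarith
  have hDm0 : 0 ≤ Dm := le_trans (MM_nonneg hw1 _) (hD 0)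
  set B := 2 * Real.sqrt (c * (Dm + 1)) + 1 with hBdef
  have hB : ∀ n, ∀ x ∈ Icc (1:ℝ) 2, |v n x| ≤ B := by
    intro n x hx
    have h1 := sup_bound' hw hw1 (hadm n) hc (hmass n) hx
    have h2 : Real.sqrt (c * (MM w (v' n) + 1)) ≤ Real.sqrt (c * (Dm + 1)) := by
      apply Real.sqrt_le_sqrt
      have := hD n
      gcongr
    have h3 := Real.sqrt_nonneg (c * (Dm + 1))
    apply abs_le_of_sq_le_sq _ (by positivity)
    nlinarith
  have hK : ∀ n, ∀ x ∈ Icc (1:ℝ) 2, ∀ y ∈ Icc (1:ℝ) 2,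
      |v n x - v n y| ≤ (Dm + 1) * Real.sqrt |x - y| := by
    intro n x hx y hy
    refine (holder hw hw1 (hadm n) hx hy).trans ?_
    have := hD n
    gcongr
  obtain ⟨u0, φ, hu0, hφ, hlim⟩ := compact_seq v hB hK
  -- regularised sequence
  have hreg := fun n : ℕ => regularize hw hw1 (hadm (φ n)) (ε := 1 / ((n:ℝ) + 1)) (by positivity)
  choose z z' hz hzD hzv using hreg
  have heps : Tendsto (fun n : ℕ => 1 / ((n:ℝ) + 1)) atTop (𝓝 0) :=
    tendsto_one_div_add_atTop_nhds_zero_nat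
  have hzlim : ∀ x ∈ Icc (1:ℝ) 2, Tendsto (fun n => z n x) atTop (𝓝 |u0 x|) := by
    intro x hx
    have h1 := (hlim x hx).abs
    have h2 : Tendsto (fun n => z n x - |v (φ n) x|) atTop (𝓝 0) :=
      squeeze_zero_norm (fun n => hzv n x) heps
    simpa using h2.add h1
  have hzB : ∀ n, ∀ x ∈ Icc (1:ℝ) 2, |z n x| ≤ B + 1 := by
    intro n x hx
    have h1 := hzv n x
    have h2 := hB (φ n) x hx
    have h3 : 1 / ((n:ℝ) + 1) ≤ 1 := by
      rw [div_le_one (by positivity)]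
      have : (0:ℝ) ≤ n := by positivity
      linarith
    have h4 : |z n x| ≤ |z n x - abs (v (φ n) x)| + |v (φ n) x| := by
      have := abs_add_le (z n x - |v (φ n) x|) (|v (φ n) x|)
      simpa using this
    linarith
  have hvc : ∀ n, Continuous (v (φ n)) := fun n => (hadm (φ n)).cont
  have hBφ : ∀ n, ∀ x ∈ Icc (1:ℝ) 2, |v (φ n) x| ≤ B := fun n => hB (φ n)
  have hMu0 : MM w u0 = c := by
    have h1 := limit_lemma (G := fun x y => y ^ 2 * w x) (by fun_prop) hvc hBφ hlim
    have h2 : (fun n => ∫ x in (1:ℝ)..2, (v (φ n) x) ^ 2 * w x) = fun _ => c :=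
      funext fun n => hmass (φ n)
    rw [h2] at h1
    exact tendsto_nhds_unique h1 tendsto_const_nhds
  have hPu0 : Tendsto (fun n => PP p w (v (φ n))) atTop (𝓝 (PP p w u0)) := by
    refine limit_lemma (G := fun x y => |y| ^ p * w x) ?_ hvc hBφ hlim
    exact (continuous_snd.abs.rpow_const (fun x => Or.inr (by linarith))).mul
      (hw.comp continuous_fst)
  have hPabs : PP p w (fun x => |u0 x|) = PP p w u0 := by unfold PP; simp
  set d := 2 * (I + k / p * PP p w u0) with hd
  have hDlim : Tendsto (fun n => MM w (v' (φ n))) atTop (𝓝 d) := by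
    have h1 : Tendsto (fun n => 2 * (e (φ n) + k / p * PP p w (v (φ n)))) atTop (𝓝 d) :=
      ((hetend.comp hφ.tendsto_atTop).add (hPu0.const_mul _)).const_mul 2
    refine h1.congr fun n => ?_
    rw [hE, EE]; ring
  refine ⟨fun x => |u0 x|, d, I, hu0.abs, fun x => abs_nonneg _, ?_, ?_, hI, ?_⟩
  · rw [← hMu0]; unfold MM; simp
  · rw [hPabs, hd]; ring
  intro η η' f hη hf hder t hpos
  have hηc := hη.cont
  have hzc : ∀ n, Continuous (z n) := fun n => (hz n).cont
  have l1 : Tendsto (fun n => MM w (fun x => z n x + t * η x)) atTop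
      (𝓝 (MM w (fun x => |u0 x| + t * η x))) :=
    limit_lemma (G := fun x y => (y + t * η x) ^ 2 * w x) (by fun_prop) hzc hzB hzlim
  have l2 : Tendsto (fun n => PP p w (fun x => z n x + t * η x)) atTop
      (𝓝 (PP p w (fun x => |u0 x| + t * η x))) := by
    refine limit_lemma (G := fun x y => |y + t * η x| ^ p * w x) ?_ hzc hzB hzlim
    refine Continuous.mul ?_ (hw.comp continuous_fst)
    refine Continuous.rpow_const ?_ (fun x => Or.inr (by linarith))
    fun_prop
  have l3 : Tendsto (fun n => ∫ x in (1:ℝ)..2, z n x * f x) atTop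
      (𝓝 (∫ x in (1:ℝ)..2, |u0 x| * f x)) :=
    limit_lemma (G := fun x y => y * f x) (by fun_prop) hzc hzB hzlim
  have l4 : Tendsto (fun n => c / MM w (fun x => z n x + t * η x)) atTop
      (𝓝 (c / MM w (fun x => |u0 x| + t * η x))) := tendsto_const_nhds.div l1 hpos.ne'
  have l5 : Tendsto (fun n => (c / MM w (fun x => z n x + t * η x)) ^ (p / 2)) atTop
      (𝓝 ((c / MM w (fun x => |u0 x| + t * η x)) ^ (p / 2))) :=
    l4.rpow_const (Or.inr (by linarith))
  have L := ((l4.mul ((hDlim.sub (l3.const_mul (2 * t))).add_const (t ^ 2 * MM w η'))).div_const 2).sub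
    ((l5.mul l2).const_mul (k / p))
  refine ge_of_tendsto L ?_
  filter_upwards [l1.eventually (lt_mem_nhds hpos)] with n hn
  have h1 := scaling hc hI ((hz n).add_smul hη t) hn
  rw [MM_add hw (hz n) hη hf hder t] at h1
  refine h1.trans ?_
  have h2 := hzD n
  have h3 : 0 ≤ c / MM w (fun x => z n x + t * η x) := by positivity
  gcongr

lemma rpow_tangent {p : ℝ} (hp : 2 < p) {a : ℝ} (ha : 0 ≤ a) (h : ℝ) :
    a ^ p + p * (a ^ (p - 1) * h) ≤ |a + h| ^ p := by
  rcases eq_or_lt_of_le ha with rfl | hpos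
  · rw [Real.zero_rpow (by linarith), Real.zero_rpow (by linarith)]
    simp; positivity
  have e1 : a ^ (p - 1) * a = a ^ p := by
    rw [← Real.rpow_add_one hpos.ne']; congr 1; ring
  have hap : 0 < a ^ p := by positivity
  have e2 : a ^ p + p * (a ^ (p - 1) * h) = a ^ p * (1 + p * (h / a)) := by
    rw [← e1]; field_simp
  rw [e2]
  rcases le_or_gt (-1) (h / a) with hs | hs
  · have h1 := one_add_mul_self_le_rpow_one_add hs (show (1:ℝ) ≤ p by linarith)
    have h2 : |a + h| = a * (1 + h / a) := by
      have : a + h = a * (1 + h / a) := by field_simp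
      rw [this, abs_of_nonneg]
      exact mul_nonneg ha (by linarith)
    rw [h2, Real.mul_rpow ha (by linarith)]
    exact mul_le_mul_of_nonneg_left h1 hap.le
  · have : 1 + p * (h / a) ≤ 0 := by nlinarith
    have h2 : a ^ p * (1 + p * (h / a)) ≤ 0 := mul_nonpos_of_nonneg_of_nonpos hap.le this
    exact h2.trans (by positivity)

lemma PP_tangent {p : ℝ} (hp : 2 < p) {w u η : ℝ → ℝ} (hw : Continuous w) (hw1 : ∀ x, 1 ≤ w x)
    (hu : Continuous u) (hu0 : ∀ x, 0 ≤ u x) (hη : Continuous η) (t : ℝ) :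
    PP p w u + p * t * (∫ x in (1:ℝ)..2, u x ^ (p - 1) * η x * w x) ≤
      PP p w (fun x => u x + t * η x) := by
  have c1 : Continuous fun x => |u x| ^ p * w x :=
    (hu.abs.rpow_const (fun x => Or.inr (by linarith))).mul hw
  have c2 : Continuous fun x => u x ^ (p - 1) * η x * w x :=
    ((hu.rpow_const (fun x => Or.inr (by linarith))).mul hη).mul hw
  have c3 : Continuous fun x => |u x + t * η x| ^ p * w x :=
    ((hu.add (continuous_const.mul hη)).abs.rpow_const (fun x => Or.inr (by linarith))).mul hw
  unfold PP
  rw [← intervalIntegral.integral_const_mul, ← intervalIntegral.integral_add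
    (c1.intervalIntegrable _ _) ((c2.const_mul (p * t)).intervalIntegrable _ _)]
  apply intervalIntegral.integral_mono_on (by norm_num)
    ((c1.add (c2.const_mul (p * t))).intervalIntegrable _ _) (c3.intervalIntegrable _ _)
  intro x _
  have h1 := rpow_tangent hp (hu0 x) (t * η x)
  have h2 := mul_le_mul_of_nonneg_right h1 (by linarith [hw1 x] : 0 ≤ w x)
  simp only [Pi.add_apply]
  rw [abs_of_nonneg (hu0 x)]
  calc _ = _ := by ring
    _ ≤ _ := h2

lemma calc_EL {c d L m' b m2 P J k p I : ℝ} (hc : 0 < c) (hp : 2 < p)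
    (hI : d / 2 - k / p * P = I)
    (h : ∀ t : ℝ, 0 < c + 2 * t * b + t ^ 2 * m2 →
      I ≤ c / (c + 2 * t * b + t ^ 2 * m2) * (d - 2 * t * L + t ^ 2 * m') / 2 -
        k / p * ((c / (c + 2 * t * b + t ^ 2 * m2)) ^ (p / 2) * (P + p * t * J))) :
    L = (k * P - d) / c * b - k * J := by
  set M : ℝ → ℝ := fun t => c + 2 * t * b + t ^ 2 * m2 with hMdef
  set g : ℝ → ℝ := fun t => c / M t * (d - 2 * t * L + t ^ 2 * m') / 2 -
        k / p * ((c / M t) ^ (p / 2) * (P + p * t * J)) with hg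
  have hM0 : M 0 = c := by simp [hMdef]
  have hid := hasDerivAt_id (0:ℝ)
  have hMd : HasDerivAt M (2 * b) 0 := by
    have := (((hid.const_mul 2).mul_const b).const_add c).add ((hid.fun_pow 2).mul_const m2)
    refine this.congr_deriv ?_
    simp
  have hsd : HasDerivAt (fun t => c / M t) (-(2 * b) / c) 0 := by
    have := (hasDerivAt_const (0:ℝ) c).fun_div hMd (by rw [hM0]; exact hc.ne')
    refine this.congr_deriv ?_
    rw [hM0]; field_simp; ring
  have hs0 : c / M 0 = 1 := by rw [hM0]; field_simp
  have hrd : HasDerivAt (fun t => (c / M t) ^ (p / 2)) (-(2 * b) / c * (p / 2)) 0 := by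
    have := hsd.rpow_const (p := p / 2) (Or.inl (by rw [hs0]; norm_num))
    refine this.congr_deriv ?_
    rw [hs0]; simp
  have hqd : HasDerivAt (fun t => d - 2 * t * L + t ^ 2 * m') (-(2 * L)) 0 := by
    have := (((hid.const_mul 2).mul_const L).const_sub d).add ((hid.fun_pow 2).mul_const m')
    refine this.congr_deriv ?_
    simp
  have hld : HasDerivAt (fun t => P + p * t * J) (p * J) 0 := by
    have := ((hid.const_mul p).mul_const J).const_add P
    refine this.congr_deriv ?_
    simp
  have hgd : HasDerivAt g (((-(2 * b) / c) * d + (-(2 * L))) / 2 -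
      k / p * ((-(2 * b) / c * (p / 2)) * P + p * J)) 0 := by
    have := ((hsd.fun_mul hqd).div_const 2).fun_sub ((hrd.fun_mul hld).const_mul (k / p))
    refine this.congr_deriv ?_
    rw [hs0]; simp
  have hmin : IsLocalMin g 0 := by
    have hev : ∀ᶠ t in 𝓝 (0:ℝ), 0 < M t :=
      hMd.continuousAt.eventually (lt_mem_nhds (by rw [hM0]; exact hc))
    have hg0 : g 0 = I := by
      simp only [hg]
      rw [hs0, ← hI]; simp
    filter_upwards [hev] with t ht
    rw [hg0]
    exact h t ht
  have h0 := hmin.hasDerivAt_eq_zero hgd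
  have hp0 : p ≠ 0 := by linarith
  have hc0 := hc.ne'
  field_simp at h0 ⊢
  linarith

lemma solve {w : ℝ → ℝ} (hw : Continuous w) (hw1 : ∀ x, 1 ≤ w x) {h : ℝ → ℝ}
    (hh : Continuous h) : ∃ U U' : ℝ → ℝ, Adm U U' ∧
      ∀ x, HasDerivAt (fun y => w y * U' y) (h x) x := by
  have hw0 : ∀ x, w x ≠ 0 := fun x => by have := hw1 x; positivity
  set H : ℝ → ℝ := fun x => ∫ y in (1:ℝ)..x, h y with hH
  have hHd : ∀ x, HasDerivAt H (h x) x := fun x =>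
    intervalIntegral.integral_hasDerivAt_right (hh.intervalIntegrable _ _)
      hh.aestronglyMeasurable.stronglyMeasurableAtFilter hh.continuousAt
  have hHc : Continuous H := continuous_iff_continuousAt.2 fun x => (hHd x).continuousAt
  set Z := ∫ y in (1:ℝ)..2, 1 / w y with hZ
  have c1 : Continuous fun y => 1 / w y := continuous_const.div hw hw0
  have c2 : Continuous fun y => H y / w y := hHc.div hw hw0
  have hZpos : 0 < Z := by
    apply intervalIntegral.integral_pos (by norm_num) c1.continuousOn
    · intro y _
      have := hw1 y
      positivity
    · refine ⟨1, by constructor <;> norm_num, ?_⟩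
      have := hw1 1
      positivity
  set A := -(∫ y in (1:ℝ)..2, H y / w y) / Z with hA
  set U' : ℝ → ℝ := fun y => A * (1 / w y) + H y / w y with hU'
  have c3 : Continuous U' := (c1.const_mul A).add c2
  refine ⟨fun x => ∫ y in (1:ℝ)..x, U' y, U', ⟨?_, c3, ?_, ?_⟩, ?_⟩
  · intro x
    exact intervalIntegral.integral_hasDerivAt_right (c3.intervalIntegrable _ _)
      c3.aestronglyMeasurable.stronglyMeasurableAtFilter c3.continuousAt
  · simp
  · simp only [hU']
    rw [intervalIntegral.integral_add ((c1.const_mul A).intervalIntegrable _ _)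
      (c2.intervalIntegrable _ _), intervalIntegral.integral_const_mul, ← hZ, hA]
    field_simp; ring
  · intro x
    have e : (fun y => w y * U' y) = fun y => A + H y := by
      ext y
      have := hw0 y
      simp only [hU']; field_simp
    rw [e]
    exact (hHd x).const_add A

lemma ibp2 {w U U' η η' h f : ℝ → ℝ} (hU : Adm U U') (hη : Adm η η')
    (hh : Continuous h) (hf : Continuous f)
    (h1 : ∀ x, HasDerivAt (fun y => w y * U' y) (h x) x)
    (h2 : ∀ x, HasDerivAt (fun y => w y * η' y) (f x) x) :
    ∫ x in (1:ℝ)..2, U x * f x = ∫ x in (1:ℝ)..2, η x * h x := by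
  have i1 := intervalIntegral.integral_mul_deriv_eq_deriv_mul (a := 1) (b := 2)
    (fun x _ => hU.1 x) (fun x _ => h2 x)
    (hU.2.1.intervalIntegrable _ _) (hf.intervalIntegrable _ _)
  have i2 := intervalIntegral.integral_mul_deriv_eq_deriv_mul (a := 1) (b := 2)
    (fun x _ => hη.1 x) (fun x _ => h1 x)
    (hη.2.1.intervalIntegrable _ _) (hh.intervalIntegrable _ _)
  rw [i1, i2, hU.2.2.1, hU.2.2.2, hη.2.2.1, hη.2.2.2]
  have : (∫ x in (1:ℝ)..2, U' x * (w x * η' x)) = ∫ x in (1:ℝ)..2, η' x * (w x * U' x) := by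
    congr 1; ext x; ring
  rw [this]; ring

theorem main_exist {p : ℝ} (hp : 2 < p) (hp6 : p < 6) {w : ℝ → ℝ} (hw : Continuous w)
    (hw1 : ∀ x, 1 ≤ w x) {c : ℝ} (hc : 0 < c) {k : ℝ} (hk : 0 ≤ k) :
    ∃ (u u' h : ℝ → ℝ) (d lam : ℝ), Adm u u' ∧ (∀ x ∈ Icc (1:ℝ) 2, 0 ≤ u x) ∧ MM w u = c ∧
      lam * c = k * PP p w u - d ∧
      (∀ v v' : ℝ → ℝ, Adm v v' → MM w v = c → d / 2 - k / p * PP p w u ≤ EE p k w v v') ∧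
      Continuous h ∧ (∀ x, HasDerivAt (fun y => w y * u' y) (h x) x) ∧
      ∀ x ∈ Icc (1:ℝ) 2, h x = w x * (lam * u x - k * u x ^ (p - 1)) := by
  obtain ⟨u, d, I, hu, hu0, hM, hdI, hI, hvar⟩ := exists_limit hp hp6 hw hw1 hc hk
  set lam := (k * PP p w u - d) / c with hlam
  have hupc : Continuous fun x => u x ^ (p - 1) := hu.rpow_const (fun x => Or.inr (by linarith))
  set h : ℝ → ℝ := fun x => w x * (lam * u x - k * u x ^ (p - 1)) with hh
  have hhc : Continuous h := hw.mul ((hu.const_mul lam).sub (hupc.const_mul k))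
  obtain ⟨U, U', hU, hUd⟩ := solve hw hw1 hhc
  have hEL : ∀ η η' f : ℝ → ℝ, Adm η η' → Continuous f →
        (∀ x, HasDerivAt (fun y => w y * η' y) (f x) x) →
        ∫ x in (1:ℝ)..2, u x * f x = ∫ x in (1:ℝ)..2, η x * h x := by
    intro η η' f hη hf hder
    have hηc := hη.cont
    have hMt : ∀ t, MM w (fun x => u x + t * η x) =
        c + 2 * t * (∫ x in (1:ℝ)..2, u x * η x * w x) + t ^ 2 * MM w η := by
      intro t
      have e : MM w (fun x => u x + t * η x) = ∫ x in (1:ℝ)..2, (u x ^ 2 * w x +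
          2 * t * (u x * η x * w x) + t ^ 2 * (η x ^ 2 * w x)) := by
        unfold MM; congr 1; ext x; ring
      rw [e, intervalIntegral.integral_add, intervalIntegral.integral_add,
        intervalIntegral.integral_const_mul, intervalIntegral.integral_const_mul]
      · rw [← hM]; unfold MM; ring
      all_goals exact (by fun_prop : Continuous _).intervalIntegrable _ _
    have key := calc_EL (L := ∫ x in (1:ℝ)..2, u x * f x) (m' := MM w η')
      (b := ∫ x in (1:ℝ)..2, u x * η x * w x) (m2 := MM w η)
      (J := ∫ x in (1:ℝ)..2, u x ^ (p - 1) * η x * w x) hc hp hdI (by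
        intro t ht
        rw [← hMt t] at ht ⊢
        refine (hvar η η' f hη hf hder t ht).trans ?_
        have := PP_tangent hp hw hw1 hu hu0 hηc t
        gcongr)
    rw [key, ← hlam, ← intervalIntegral.integral_const_mul, ← intervalIntegral.integral_const_mul,
      ← intervalIntegral.integral_sub]
    · congr 1; ext x; simp only [hh]; ring
    · exact (by fun_prop : Continuous _).intervalIntegrable _ _
    · exact (((hupc.mul hηc).mul hw).const_mul k).intervalIntegrable _ _
  have hUc := hU.cont
  have heq : ∀ x ∈ Icc (1:ℝ) 2, u x = U x := by
    have hfc : Continuous fun x => u x - U x := hu.sub hUc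
    obtain ⟨η, η', hη, hηd⟩ := solve hw hw1 hfc
    have e1 := hEL η η' _ hη hfc hηd
    have e2 := ibp2 hU hη hhc hfc hUd hηd
    have e3 : ∫ x in (1:ℝ)..2, (u x - U x) ^ 2 = 0 := by
      have : (∫ x in (1:ℝ)..2, (u x - U x) ^ 2) =
          ∫ x in (1:ℝ)..2, (u x * (u x - U x) - U x * (u x - U x)) := by
        congr 1; ext x; ring
      rw [this, intervalIntegral.integral_sub, e1, e2, sub_self]
      all_goals exact (by fun_prop : Continuous _).intervalIntegrable _ _
    intro x hx
    by_contra hne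
    have : 0 < ∫ x in (1:ℝ)..2, (u x - U x) ^ 2 := by
      apply intervalIntegral.integral_pos (by norm_num) (by fun_prop)
      · intro y _
        positivity
      · refine ⟨x, hx, ?_⟩
        have : u x - U x ≠ 0 := sub_ne_zero.2 hne
        positivity
    linarith
  have hsub : ∀ x, x ∈ uIcc (1:ℝ) 2 → x ∈ Icc (1:ℝ) 2 := by
    intro x hx
    rwa [uIcc_of_le (by norm_num)] at hx
  have hMU : MM w U = MM w u := by
    apply intervalIntegral.integral_congr
    intro x hx
    simp only [heq x (hsub x hx)]
  have hPU : PP p w U = PP p w u := by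
    apply intervalIntegral.integral_congr
    intro x hx
    simp only [heq x (hsub x hx)]
  refine ⟨U, U', h, d, lam, hU, ?_, by rw [hMU, hM], ?_, ?_, hhc, hUd, ?_⟩
  · intro x hx
    rw [← heq x hx]; exact hu0 x
  · rw [hPU, hlam]; field_simp
  · rw [hPU, hdI]; exact hI
  · intro x hx
    rw [← heq x hx]

lemma uIcc12 {x : ℝ} (hx : x ∈ uIcc (1:ℝ) 2) : x ∈ Icc (1:ℝ) 2 := by
  rwa [uIcc_of_le (by norm_num)] at hx

lemma positivity_lemma {p k lam c : ℝ} (hp : 2 < p) {w u u' h : ℝ → ℝ} (hw : Continuous w)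
    (hw1 : ∀ x, 1 ≤ w x) (hu : Adm u u') (hu0 : ∀ x ∈ Icc (1:ℝ) 2, 0 ≤ u x)
    (hc : 0 < c) (hM : MM w u = c)
    (hd : ∀ x, HasDerivAt (fun y => w y * u' y) (h x) x)
    (hh : ∀ x ∈ Icc (1:ℝ) 2, h x = w x * (lam * u x - k * u x ^ (p - 1))) :
    ∀ x ∈ Ioo (1:ℝ) 2, 0 < u x := by
  intro r hr
  have huc := hu.cont
  by_contra hneg
  have hr' : r ∈ Icc (1:ℝ) 2 := Ioo_subset_Icc_self hr
  have hur : u r = 0 := le_antisymm (not_lt.1 hneg) (hu0 r hr')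
  have hmin : IsLocalMin u r := by
    filter_upwards [isOpen_Ioo.mem_nhds hr] with x hx
    rw [hur]; exact hu0 x (Ioo_subset_Icc_self hx)
  have hu'r : u' r = 0 := hmin.hasDerivAt_eq_zero (hu.1 r)
  set z : ℝ → ℝ := fun y => w y * u' y with hz
  have hzc : Continuous z := hw.mul hu.2.1
  have hbc : Continuous fun x => w x * (lam - k * u x ^ (p - 2)) :=
    hw.mul (continuous_const.sub ((huc.rpow_const (fun x => Or.inr (by linarith))).const_mul k))
  obtain ⟨K0, hK0⟩ := isCompact_Icc.exists_bound_of_continuousOn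
    (s := Icc (1:ℝ) 2) hbc.continuousOn
  have hb : ∀ x ∈ Icc (1:ℝ) 2, |h x| ≤ K0 * |u x| := by
    intro x hx
    have h1 := hK0 x hx
    have h2 : h x = (w x * (lam - k * u x ^ (p - 2))) * u x := by
      rw [hh x hx]
      have : u x ^ (p - 1) = u x ^ (p - 2) * u x := by
        rcases eq_or_lt_of_le (hu0 x hx) with h0 | h0
        · rw [← h0, Real.zero_rpow (by linarith)]; simp
        · rw [← Real.rpow_add_one h0.ne']; congr 1; ring
      rw [this]; ring
    rw [h2, abs_mul]
    exact mul_le_mul_of_nonneg_right h1 (abs_nonneg _)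
  set e : ℝ → ℝ := fun x => u x ^ 2 + z x ^ 2 with he
  have hed : ∀ x, HasDerivAt e (2 * u x * u' x + 2 * z x * h x) x := by
    intro x
    have := ((hu.1 x).fun_pow 2).fun_add ((hd x).fun_pow 2)
    refine this.congr_deriv ?_
    simp [hz]
  set K := 1 + |K0| with hK
  have hbd : ∀ x ∈ Icc (1:ℝ) 2, |2 * u x * u' x + 2 * z x * h x| ≤ K * e x := by
    intro x hx
    have a1 : |u' x| ≤ |z x| := by
      simp only [hz, abs_mul]
      have := hw1 x
      rw [abs_of_nonneg (by linarith : 0 ≤ w x)]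
      exact le_mul_of_one_le_left (abs_nonneg _) this
    have a2 : |h x| ≤ |K0| * |u x| :=
      (hb x hx).trans (mul_le_mul_of_nonneg_right (le_abs_self _) (abs_nonneg _))
    have a3 : |2 * u x * u' x + 2 * z x * h x| ≤ 2 * |u x| * |u' x| + 2 * |z x| * |h x| := by
      refine (abs_add_le _ _).trans (le_of_eq ?_)
      simp [abs_mul]
    have a4 : e x = |u x| ^ 2 + |z x| ^ 2 := by simp [he]
    have b1 : 2 * |u x| * |u' x| ≤ 2 * |u x| * |z x| := by gcongr
    have b2 : 2 * |z x| * |h x| ≤ 2 * |z x| * (|K0| * |u x|) := by gcongr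
    rw [a4, hK]
    nlinarith [sq_nonneg (|u x| - |z x|), mul_nonneg (abs_nonneg K0) (sq_nonneg (|u x| - |z x|))]
  have hexp : ∀ s x : ℝ, HasDerivAt (fun y => e y * Real.exp (s * y))
      ((2 * u x * u' x + 2 * z x * h x) * Real.exp (s * x) + e x * (Real.exp (s * x) * s)) x := by
    intro s x
    have h1 : HasDerivAt (fun y : ℝ => s * y) s x := by
      simpa using (hasDerivAt_id x).const_mul s
    exact (hed x).fun_mul h1.exp
  have her : e r = 0 := by simp [he, hz, hur, hu'r]
  have hanti : AntitoneOn (fun y => e y * Real.exp ((-K) * y)) (Icc 1 2) := by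
    apply antitoneOn_of_deriv_nonpos (convex_Icc 1 2)
    · exact fun x _ => (hexp (-K) x).continuousAt.continuousWithinAt
    · exact fun x _ => (hexp (-K) x).differentiableAt.differentiableWithinAt
    · intro x hx
      rw [interior_Icc] at hx
      rw [(hexp (-K) x).deriv]
      have h1 := (abs_le.1 (hbd x (Ioo_subset_Icc_self hx))).2
      have := Real.exp_pos (-K * x)
      nlinarith
  have hmono : MonotoneOn (fun y => e y * Real.exp (K * y)) (Icc 1 2) := by
    apply monotoneOn_of_deriv_nonneg (convex_Icc 1 2)
    · exact fun x _ => (hexp K x).continuousAt.continuousWithinAt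
    · exact fun x _ => (hexp K x).differentiableAt.differentiableWithinAt
    · intro x hx
      rw [interior_Icc] at hx
      rw [(hexp K x).deriv]
      have h1 := (abs_le.1 (hbd x (Ioo_subset_Icc_self hx))).1
      have := Real.exp_pos (K * x)
      nlinarith
  have hzero : ∀ x ∈ Icc (1:ℝ) 2, u x = 0 := by
    intro x hx
    have hle : e x ≤ 0 := by
      rcases le_total r x with hrx | hrx
      · have := hanti hr' hx hrx
        simp only [her, zero_mul] at this
        have hp := Real.exp_pos (-K * x)
        by_contra hcon
        have := mul_pos (not_le.1 hcon) hp
        linarith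
      · have := hmono hx hr' hrx
        simp only [her, zero_mul] at this
        have hp := Real.exp_pos (K * x)
        by_contra hcon
        have := mul_pos (not_le.1 hcon) hp
        linarith
    have : u x ^ 2 ≤ 0 := by
      have : 0 ≤ z x ^ 2 := by positivity
      simp only [he] at hle
      linarith
    exact pow_eq_zero_iff (two_ne_zero) |>.1 (le_antisymm this (by positivity))
  have : MM w u = 0 := by
    unfold MM
    rw [intervalIntegral.integral_congr (g := fun _ => (0:ℝ))]
    · simp
    · intro x hx
      simp [hzero x (uIcc12 hx)]
  linarith

def ww (N : ℕ) (x : ℝ) : ℝ := cl x ^ (N - 1)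

lemma ww_cont (N : ℕ) : Continuous (ww N) := cl_cont.pow _

lemma ww_one (N : ℕ) (x : ℝ) : 1 ≤ ww N x := one_le_pow₀ (cl_mem x).1

lemma ww_eq (N : ℕ) {x : ℝ} (hx : x ∈ Icc (1:ℝ) 2) : ww N x = x ^ (N - 1) := by
  rw [ww, cl_eq hx]

lemma mass_eq (N : ℕ) (u : ℝ → ℝ) : mass N u = MM (ww N) u := by
  apply intervalIntegral.integral_congr
  intro x hx
  simp only [ww_eq N (uIcc12 hx)]

lemma extend_test (N : ℕ) {φ : ℝ → ℝ} (h : ContDiffOn ℝ 1 φ (Icc 1 2)) (h1 : φ 1 = 0)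
    (h2 : φ 2 = 0) : ∃ v v' : ℝ → ℝ, Adm v v' ∧ (∀ x ∈ Icc (1:ℝ) 2, v x = φ x) ∧
      (∫ r in (1:ℝ)..2, (deriv φ r) ^ 2 * r ^ (N - 1)) = MM (ww N) v' ∧
      (∫ r in (1:ℝ)..2, (φ r) ^ 2 * r ^ (N - 1)) = MM (ww N) v := by
  have hcd : ContinuousOn (derivWithin φ (Icc 1 2)) (Icc 1 2) :=
    h.continuousOn_derivWithin (uniqueDiffOn_Icc (by norm_num)) le_rfl
  set v' : ℝ → ℝ := fun x => derivWithin φ (Icc 1 2) (cl x) with hv'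
  have hv'c : Continuous v' := hcd.comp_continuous cl_cont cl_mem
  have hder : ∀ x ∈ Ioo (1:ℝ) 2, HasDerivAt φ (v' x) x := by
    intro x hx
    have hx' := Ioo_subset_Icc_self hx
    have h3 := (h.differentiableOn (by norm_num) x hx').hasDerivWithinAt
    simp only [hv', cl_eq hx']
    exact h3.hasDerivAt (Icc_mem_nhds hx.1 hx.2)
  have hvd : ∀ x, HasDerivAt (fun x => ∫ y in (1:ℝ)..x, v' y) (v' x) x := fun x =>
    intervalIntegral.integral_hasDerivAt_right (hv'c.intervalIntegrable _ _)
      hv'c.aestronglyMeasurable.stronglyMeasurableAtFilter hv'c.continuousAt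
  have heq : ∀ x ∈ Icc (1:ℝ) 2, ∫ y in (1:ℝ)..x, v' y = φ x := by
    intro x hx
    rw [intervalIntegral.integral_eq_sub_of_hasDerivAt_of_le hx.1
      (h.continuousOn.mono (Icc_subset_Icc_right hx.2))
      (fun y hy => hder y ⟨hy.1, hy.2.trans_le hx.2⟩) (hv'c.intervalIntegrable _ _), h1, sub_zero]
  refine ⟨fun x => ∫ y in (1:ℝ)..x, v' y, v', ⟨hvd, hv'c, by simp, ?_⟩, heq, ?_, ?_⟩
  · exact (heq 2 (by constructor <;> norm_num)).trans h2
  · unfold MM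
    rw [intervalIntegral.integral_of_le (by norm_num), intervalIntegral.integral_of_le (by norm_num),
      integral_Ioc_eq_integral_Ioo, integral_Ioc_eq_integral_Ioo]
    apply setIntegral_congr_fun measurableSet_Ioo
    intro x hx
    simp only [(hder x hx).deriv, ww_eq N (Ioo_subset_Icc_self hx)]
  · apply intervalIntegral.integral_congr
    intro x hx
    simp only [heq x (uIcc12 hx), ww_eq N (uIcc12 hx)]

lemma main_core (N : ℕ) (hN : 2 ≤ N) (p : ℝ) (hp : 2 < p) (hp6 : p < 6) (c : ℝ) (hc : 0 < c) :
    ∃ lam : ℝ, -lambda1 N < lam ∧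
      ∃ u : ℝ → ℝ, IsPosRadSol N p lam u ∧ mass N u = c := by
  have hw := ww_cont N
  have hw1 := ww_one N
  obtain ⟨u, u', h, d, lam, hu, hu0, hM, -, -, hhc, hd, hh⟩ :=
    main_exist hp hp6 hw hw1 hc (k := 1) (by norm_num)
  obtain ⟨f, f', g, d1, mu, hf, hf0, hfM, hmu, hfmin, hgc, hfd, hg⟩ :=
    main_exist hp hp6 hw hw1 (c := 1) one_pos (k := 0) le_rfl
  have huc := hu.cont
  have hfc := hf.cont
  have hupos := positivity_lemma hp hw hw1 hu hu0 hc hM hd hh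
  -- the eigenvalue bound
  have hlam1 : d1 ≤ lambda1 N := by
    apply le_csInf
    · obtain ⟨v, v', hv, hvM⟩ := exists_test hw hw1 one_pos
      refine ⟨_, v, ?_, hv.2.2.1, hv.2.2.2, ?_, rfl⟩
      · apply ContDiff.contDiffOn
        rw [contDiff_one_iff_deriv]
        have : deriv v = v' := funext fun x => (hv.1 x).deriv
        rw [this]
        exact ⟨fun x => (hv.1 x).differentiableAt, hv.2.1⟩
      · by_contra hcon
        push Not at hcon
        have : MM (ww N) v = 0 := by
          unfold MM
          rw [intervalIntegral.integral_congr (g := fun _ => (0:ℝ))]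
          · simp
          · intro x hx
            simp [hcon x (uIcc12 hx)]
        linarith
    · rintro q ⟨φ, hφ, hφ1, hφ2, ⟨r, hr, hne⟩, rfl⟩
      obtain ⟨v, v', hv, hvφ, e1, e2⟩ := extend_test N hφ hφ1 hφ2
      rw [e1, e2]
      have hpos : 0 < MM (ww N) v := MM_pos hw hw1 hv.cont hr (by rwa [hvφ r hr])
      have := scaling (p := p) (k := 0) one_pos (I := d1 / 2) (fun z z' hz hzM => by
        have := hfmin z z' hz hzM
        simpa using this) hv hpos
      simp only [zero_div, zero_mul, sub_zero] at this
      have e3 : MM (ww N) v' / MM (ww N) v = 1 / MM (ww N) v * MM (ww N) v' := by ring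
      rw [e3]; linarith
  refine ⟨lam, ?_, u, ⟨?_, hupos, hu.2.2.1, hu.2.2.2, ?_⟩, ?_⟩
  · -- test with the first eigenfunction
    have i := ibp2 hu hf hhc hgc hd hfd
    have hupc : Continuous fun x => u x ^ (p - 1) :=
      huc.rpow_const (fun x => Or.inr (by linarith))
    have c1 : Continuous fun x => u x * f x * ww N x := (huc.mul hfc).mul hw
    have c2 : Continuous fun x => u x ^ (p - 1) * f x * ww N x := (hupc.mul hfc).mul hw
    have j1 : ∫ x in (1:ℝ)..2, u x * g x = mu * ∫ x in (1:ℝ)..2, u x * f x * ww N x := by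
      rw [← intervalIntegral.integral_const_mul]
      apply intervalIntegral.integral_congr
      intro x hx
      simp only [hg x (uIcc12 hx)]; ring
    have j2 : ∫ x in (1:ℝ)..2, f x * h x = lam * (∫ x in (1:ℝ)..2, u x * f x * ww N x) -
        ∫ x in (1:ℝ)..2, u x ^ (p - 1) * f x * ww N x := by
      rw [← intervalIntegral.integral_const_mul, ← intervalIntegral.integral_sub
        ((c1.const_mul lam).intervalIntegrable _ _) (c2.intervalIntegrable _ _)]
      apply intervalIntegral.integral_congr
      intro x hx
      simp only [hh x (uIcc12 hx)]; ring
    have hA : 0 ≤ ∫ x in (1:ℝ)..2, u x * f x * ww N x := by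
      apply intervalIntegral.integral_nonneg (by norm_num)
      intro x hx
      have := hw1 x
      have := hu0 x hx
      have := hf0 x hx
      positivity
    have hex : ∃ x ∈ Ioo (1:ℝ) 2, 0 < f x := by
      by_contra hcon
      push Not at hcon
      have : MM (ww N) f = 0 := by
        unfold MM
        rw [intervalIntegral.integral_congr (g := fun _ => (0:ℝ))]
        · simp
        · intro x hx
          have hx' := uIcc12 hx
          have : f x = 0 := by
            rcases eq_or_lt_of_le hx'.1 with h1 | h1
            · rw [← h1, hf.2.2.1]
            rcases eq_or_lt_of_le hx'.2 with h2 | h2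
            · rw [h2, hf.2.2.2]
            exact le_antisymm (hcon x ⟨h1, h2⟩) (hf0 x hx')
          simp [this]
      linarith
    obtain ⟨x0, hx0, hfx0⟩ := hex
    have hB : 0 < ∫ x in (1:ℝ)..2, u x ^ (p - 1) * f x * ww N x := by
      apply intervalIntegral.integral_pos (by norm_num) c2.continuousOn
      · intro x hx
        have hx' := Ioc_subset_Icc_self hx
        have := hw1 x
        have := hu0 x hx'
        have := hf0 x hx'
        positivity
      · refine ⟨x0, Ioo_subset_Icc_self hx0, ?_⟩
        have := hw1 x0
        have := hupos x0 hx0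
        positivity
    rw [j1, j2] at i
    have hmu' : mu = -d1 := by simpa using hmu
    rw [hmu'] at i
    by_contra hcon
    have : lam + d1 ≤ 0 := by linarith
    nlinarith
  · -- regularity
    have huniq : UniqueDiffOn ℝ (Icc (1:ℝ) 2) := uniqueDiffOn_Icc (by norm_num)
    have hdw : ∀ x ∈ Icc (1:ℝ) 2, derivWithin u (Icc 1 2) x = u' x := fun x hx =>
      (hu.1 x).hasDerivWithinAt.derivWithin (huniq x hx)
    have e2 : (2 : WithTop ℕ∞) = 1 + 1 := by norm_num
    rw [e2, contDiffOn_succ_iff_derivWithin huniq]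
    refine ⟨fun x _ => (hu.1 x).differentiableAt.differentiableWithinAt, by simp, ?_⟩
    have hz : ContDiff ℝ 1 (fun y => ww N y * u' y) := by
      rw [contDiff_one_iff_deriv]
      have : deriv (fun y => ww N y * u' y) = h := funext fun x => (hd x).deriv
      rw [this]
      exact ⟨fun x => (hd x).differentiableAt, hhc⟩
    have hq : ContDiffOn ℝ 1 (fun y => (ww N y * u' y) / y ^ (N - 1)) (Icc 1 2) := by
      apply hz.contDiffOn.div (contDiff_id.pow _).contDiffOn
      intro x hx
      have : 0 < x := by linarith [hx.1]
      simp only [id]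
      positivity
    refine hq.congr fun x hx => ?_
    rw [hdw x hx, ww_eq N hx]
    have : 0 < x := by linarith [hx.1]
    field_simp
  · -- the equation
    intro r hr
    have hr' := Ioo_subset_Icc_self hr
    have hr0 : 0 < r := by linarith [hr.1]
    have hdu : deriv u = u' := funext fun x => (hu.1 x).deriv
    obtain ⟨m, rfl⟩ : ∃ m, N = m + 2 := ⟨N - 2, by omega⟩
    have hev : u' =ᶠ[𝓝 r] fun y => (ww (m + 2) y * u' y) / y ^ (m + 1) := by
      filter_upwards [isOpen_Ioo.mem_nhds hr] with x hx
      rw [ww_eq _ (Ioo_subset_Icc_self hx)]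
      have : 0 < x := by linarith [hx.1]
      have e : m + 2 - 1 = m + 1 := by omega
      rw [e]
      field_simp
    have hpw : HasDerivAt (fun y : ℝ => y ^ (m + 1)) (((m + 1 : ℕ) : ℝ) * r ^ m) r := by
      simpa using hasDerivAt_pow (m + 1) r
    have hdd := ((hd r).fun_div hpw (by positivity)).congr_of_eventuallyEq hev
    rw [hdu, hdd.deriv, hh r hr', ww_eq _ hr']
    have e : m + 2 - 1 = m + 1 := by omega
    rw [e]
    push_cast
    field_simp
    ring
  · rw [mass_eq, hM]

/-- in the Sobolev-subcritical, "large-mass-attainable" regime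
(`N ≥ 3` and `2 < p < 2N/(N-2)`, or `N = 2` and `2 < p < 6`), for every `c > 0`
there exist `lam > -λ₁` and a positive radial solution `u` of (NLS_lam) with `m(u) = c`. -/
theorem stmt0 (N : ℕ) (p : ℝ)
    (hp : (3 ≤ N ∧ 2 < p ∧ p < 2 * (N : ℝ) / ((N : ℝ) - 2)) ∨ (N = 2 ∧ 2 < p ∧ p < 6)) :
    ∀ c : ℝ, 0 < c → ∃ lam : ℝ, -lambda1 N < lam ∧
      ∃ u : ℝ → ℝ, IsPosRadSol N p lam u ∧ mass N u = c := by
  intro c hc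
  rcases hp with ⟨hN, h2, h3⟩ | ⟨rfl, h2, h3⟩
  · have hN' : (3:ℝ) ≤ N := by exact_mod_cast hN
    have h6 : 2 * (N : ℝ) / ((N : ℝ) - 2) ≤ 6 := by
      rw [div_le_iff₀ (by linarith)]
      linarith
    exact main_core N (by omega) p h2 (by linarith) c hc
  · exact main_core 2 le_rfl p h2 h3 c hc
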